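/- Let Φ = (φ_{i,j}) ∈ ℝ^{m×N} and 1 ≤ K ≤ N. With D_{u,SQ}*(R) the optimal uniform scalar distortion-rate function of the measurements of a random K-sparse Gaussian signal (defined in the context) and μ₁ := (1/N) ∑_{i=1}^m ∑_{j=1}^N φ_{i,j}², one has liminf_{R→∞} (2^{2R}/(K·R)) · D_{u,SQ}*(R) ≥ (4 ln 2 / 3) · μ₁. -/

import Mathlib

open MeasureTheory ProbabilityTheory Real Filter

/-- The expected distortion `D(C)` of scalar-quantizing, with the codebook `C`, the
measurements `Y = ΦX` of a `K`-sparse signal whose support `T` is uniform over size-`K`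
subsets of `{1,…,N}` and whose nonzero entries are i.i.d. standard Gaussian. -/
noncomputable def measDist {m N : ℕ} (Φ : Matrix (Fin m) (Fin N) ℝ) (K : ℕ)
    (C : Finset ℝ) (hC : C.Nonempty) : ℝ :=
  (1 / (N.choose K : ℝ)) *
    ∑ T ∈ Finset.powersetCard K (Finset.univ : Finset (Fin N)), ∑ i : Fin m,
      ∫ y, C.inf' hC (fun c => (y - c) ^ 2)
        ∂(gaussianReal 0 (Real.toNNReal (∑ j ∈ T, (Φ i j) ^ 2)))

/-- A uniform codebook: a finite set of the form `{a + iΔ : i = 0, …, M-1}`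
for some `a ∈ ℝ`, `Δ > 0`, `M ∈ ℕ`. -/
def IsUniformCodebook (C : Finset ℝ) : Prop :=
  ∃ (a Δ : ℝ) (M : ℕ), 0 < Δ ∧
    C = Finset.image (fun i : ℕ => a + i * Δ) (Finset.range M)

/-- The optimal uniform scalar distortion-rate function `D_{u,SQ}*(R)` at rate `R` bits. -/
noncomputable def DuSQ {m N : ℕ} (Φ : Matrix (Fin m) (Fin N) ℝ) (K : ℕ) (R : ℕ) : ℝ :=
  sInf {d : ℝ | ∃ (C : Finset ℝ) (hC : C.Nonempty), IsUniformCodebook C ∧ C.card ≤ 2 ^ R ∧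
    d = measDist Φ K C hC}


open scoped NNReal ENNReal

/-- The squared distance from `y` to the lattice `a + δℤ`. -/
noncomputable def latticeSqDist (a δ y : ℝ) : ℝ :=
  (δ * ((y - a) / δ - round ((y - a) / δ))) ^ 2

lemma latticeSqDist_le {a δ y : ℝ} (hδ : δ ≠ 0) (z : ℤ) :
    latticeSqDist a δ y ≤ (y - (a + z * δ)) ^ 2 := by
  have h : y - (a + z * δ) = δ * ((y - a) / δ - z) := by field_simp; ring
  rw [latticeSqDist, h, mul_pow, mul_pow]
  exact mul_le_mul_of_nonneg_left (sq_le_sq.2 (round_le _ z)) (sq_nonneg δ)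

lemma latticeSqDist_nonneg (a δ y : ℝ) : 0 ≤ latticeSqDist a δ y := sq_nonneg _

lemma measurable_latticeSqDist (a δ : ℝ) : Measurable (latticeSqDist a δ) := by
  unfold latticeSqDist
  simp only [round_eq]
  fun_prop

lemma periodic_latticeSqDist (a : ℝ) {δ : ℝ} (hδ : δ ≠ 0) :
    Function.Periodic (latticeSqDist a δ) δ := by
  intro y
  have h : (y + δ - a) / δ = (y - a) / δ + 1 := by field_simp; ring
  rw [latticeSqDist, latticeSqDist, h, round_add_one]
  push_cast
  ring

lemma latticeSqDist_of_mem_Icc {a δ y : ℝ} (hδ : 0 < δ)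
    (hy : y ∈ Set.Icc (a - δ / 2) (a + δ / 2)) : latticeSqDist a δ y = (y - a) ^ 2 := by
  obtain ⟨h1, h2⟩ := hy
  rcases h2.lt_or_eq with h2 | rfl
  · have h0 : round ((y - a) / δ) = 0 := by
      rw [round_eq_zero_iff]
      constructor
      · rw [le_div_iff₀ hδ]; linarith
      · rw [div_lt_iff₀ hδ]; linarith
    rw [latticeSqDist, h0]
    field_simp
    simp
  · have h0 : (a + δ / 2 - a) / δ = 2⁻¹ := by field_simp; ring
    rw [latticeSqDist, h0, round_two_inv]
    push_cast
    ring

lemma intervalIntegral_latticeSqDist (a x : ℝ) {δ : ℝ} (hδ : 0 < δ) :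
    ∫ y in x..(x + δ), latticeSqDist a δ y = δ ^ 3 / 12 := by
  rw [(periodic_latticeSqDist a hδ.ne').intervalIntegral_add_eq x (a - δ / 2)]
  have h : ∫ y in (a - δ / 2)..(a - δ / 2 + δ), latticeSqDist a δ y =
      ∫ y in (a - δ / 2)..(a - δ / 2 + δ), (y - a) ^ 2 := by
    apply intervalIntegral.integral_congr
    intro y hy
    rw [Set.uIcc_of_le (by linarith)] at hy
    exact latticeSqDist_of_mem_Icc hδ ⟨hy.1, by linarith [hy.2]⟩
  rw [h, intervalIntegral.integral_comp_sub_right (fun y => y ^ 2), integral_pow]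
  push_cast
  ring

lemma latticeSqDist_le_sq (a δ y : ℝ) : latticeSqDist a δ y ≤ δ ^ 2 := by
  rw [latticeSqDist, mul_pow]
  have h := sq_le_sq' (abs_le.1 (abs_sub_round ((y - a) / δ))).1
    (abs_le.1 (abs_sub_round ((y - a) / δ))).2
  nlinarith [sq_nonneg δ]

lemma setLIntegral_latticeSqDist (a x : ℝ) {δ : ℝ} (hδ : 0 < δ) :
    ∫⁻ u in Set.Ioc 0 δ, ENNReal.ofReal (latticeSqDist a δ (x + u)) =
      ENNReal.ofReal (δ ^ 3 / 12) := by
  rw [← intervalIntegral_latticeSqDist a x hδ]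
  have h : ∫ y in x..(x + δ), latticeSqDist a δ y =
      ∫ u in (0 : ℝ)..δ, latticeSqDist a δ (x + u) := by
    rw [intervalIntegral.integral_comp_add_left (latticeSqDist a δ)]
    simp
  rw [h, intervalIntegral.integral_of_le hδ.le, ofReal_integral_eq_lintegral_ofReal]
  · refine Measure.integrableOn_of_bounded (M := δ ^ 2) (by simp) ?_ ?_
    · exact ((measurable_latticeSqDist a δ).comp (measurable_const_add x)).aestronglyMeasurable
    · filter_upwards with u
      rw [Real.norm_of_nonneg (latticeSqDist_nonneg _ _ _)]
      exact latticeSqDist_le_sq _ _ _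
  · filter_upwards with u using latticeSqDist_nonneg _ _ _

/-- Averaging over translations: if `q x` is a lower bound of `p` on `(x, x + δ]` and `g` has the
same mass `c` on all intervals of length `δ`, then the mean of `g` against `p` is at least
`c / δ` times the mass of `q`. -/
lemma lintegral_mul_le_of_le_translate {p q g : ℝ → ℝ≥0∞} (hp : Measurable p) (hg : Measurable g)
    {δ : ℝ} {c : ℝ≥0∞} (hq : Measurable q)
    (hqp : ∀ x, ∀ u ∈ Set.Ioc 0 δ, q x ≤ p (x + u))
    (hc : ∀ x, ∫⁻ u in Set.Ioc 0 δ, g (x + u) = c) :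
    (∫⁻ x, q x) * c ≤ ENNReal.ofReal δ * ∫⁻ x, p x * g x := by
  calc (∫⁻ x, q x) * c = ∫⁻ x, ∫⁻ u in Set.Ioc 0 δ, q x * g (x + u) := by
        rw [← lintegral_mul_const _ hq]
        congr 1 with x
        rw [lintegral_const_mul _ (by fun_prop), hc]
    _ ≤ ∫⁻ x, ∫⁻ u in Set.Ioc 0 δ, p (x + u) * g (x + u) := by
        refine lintegral_mono fun x => setLIntegral_mono (by fun_prop) fun u hu => ?_
        gcongr
        exact hqp x u hu
    _ = ∫⁻ u in Set.Ioc 0 δ, ∫⁻ x, p (x + u) * g (x + u) :=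
        lintegral_lintegral_swap (by unfold Function.uncurry; fun_prop)
    _ = ∫⁻ _ in Set.Ioc 0 δ, ∫⁻ x, p x * g x := by
        congr 1 with u
        exact lintegral_add_right_eq_self (fun x => p x * g x) u
    _ = ENNReal.ofReal δ * ∫⁻ x, p x * g x := by simp [mul_comm]

lemma gaussianPDFReal_le_of_abs_le (v : ℝ≥0) {x y : ℝ} (h : |x| ≤ |y|) :
    gaussianPDFReal 0 v y ≤ gaussianPDFReal 0 v x := by
  simp only [gaussianPDFReal, sub_zero]
  have := sq_le_sq.2 h
  gcongr

lemma continuous_gaussianPDFReal_zero (v : ℝ≥0) : Continuous (gaussianPDFReal 0 v) := by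
  unfold gaussianPDFReal
  fun_prop

lemma tendsto_integral_gaussianPDFReal_abs_add {v : ℝ≥0} (hv : v ≠ 0) :
    Tendsto (fun δ : ℝ => ∫ x, gaussianPDFReal 0 v (|x| + δ)) (nhdsWithin 0 (Set.Ioi 0))
      (nhds 1) := by
  have hcont := continuous_gaussianPDFReal_zero v
  rw [← integral_gaussianPDFReal_eq_one 0 hv]
  refine tendsto_integral_filter_of_dominated_convergence (gaussianPDFReal 0 v) ?_ ?_
    (integrable_gaussianPDFReal 0 v) ?_
  · filter_upwards with δ
    exact Continuous.aestronglyMeasurable (by fun_prop)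
  · filter_upwards [self_mem_nhdsWithin] with δ (hδ : 0 < δ)
    filter_upwards with x
    rw [Real.norm_of_nonneg (gaussianPDFReal_nonneg _ _ _)]
    exact gaussianPDFReal_le_of_abs_le v (by rw [abs_of_pos (a := |x| + δ) (by positivity)]; linarith)
  · filter_upwards with x
    have h : Tendsto (fun δ : ℝ => gaussianPDFReal 0 v (|x| + δ)) (nhds 0)
        (nhds (gaussianPDFReal 0 v (|x| + 0))) :=
      Continuous.tendsto (by fun_prop) 0
    have h0 : gaussianPDFReal 0 v (|x| + 0) = gaussianPDFReal 0 v x :=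
      le_antisymm (gaussianPDFReal_le_of_abs_le v (by simp))
        (gaussianPDFReal_le_of_abs_le v (by simp))
    rw [h0] at h
    exact h.mono_left nhdsWithin_le_nhds

lemma integrable_inf'_sq_sub (v : ℝ≥0) (C : Finset ℝ) (hC : C.Nonempty) :
    Integrable (fun y => C.inf' hC (fun c => (y - c) ^ 2)) (gaussianReal 0 v) := by
  obtain ⟨c, hc⟩ := id hC
  have hint : Integrable (fun y => (y - c) ^ 2) (gaussianReal 0 v) :=
    ((memLp_id_gaussianReal 2).sub (memLp_const c)).integrable_sq
  refine hint.mono' (Continuous.aestronglyMeasurable ?_) ?_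
  · exact Continuous.finset_inf'_apply _ (fun i _ => by fun_prop)
  · filter_upwards with y
    rw [Real.norm_of_nonneg (Finset.le_inf' _ _ fun _ _ => sq_nonneg _)]
    exact Finset.inf'_le _ hc

lemma inf'_sq_sub_nonneg (C : Finset ℝ) (hC : C.Nonempty) (y : ℝ) :
    0 ≤ C.inf' hC (fun c => (y - c) ^ 2) :=
  Finset.le_inf' _ _ fun _ _ => sq_nonneg _

/-- The distortion of a codebook contained in a lattice of spacing `δ`. -/
lemma mul_integral_gaussianPDFReal_le_integral_inf' {v : ℝ≥0} (hv : v ≠ 0) {a δ : ℝ} (hδ : 0 < δ)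
    (C : Finset ℝ) (hC : C.Nonempty) (hCδ : ∀ c ∈ C, ∃ z : ℤ, c = a + z * δ) :
    δ ^ 2 / 12 * ∫ x, gaussianPDFReal 0 v (|x| + δ) ≤
      ∫ y, C.inf' hC (fun c => (y - c) ^ 2) ∂(gaussianReal 0 v) := by
  have hcont := continuous_gaussianPDFReal_zero v
  have hq : Integrable (fun x => gaussianPDFReal 0 v (|x| + δ)) := by
    refine (integrable_gaussianPDFReal 0 v).mono' (Continuous.aestronglyMeasurable (by fun_prop)) ?_
    filter_upwards with x
    rw [Real.norm_of_nonneg (gaussianPDFReal_nonneg _ _ _)]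
    exact gaussianPDFReal_le_of_abs_le v (by rw [abs_of_pos (a := |x| + δ) (by positivity)]; linarith)
  have hG : ∀ y, latticeSqDist a δ y ≤ C.inf' hC (fun c => (y - c) ^ 2) := fun y =>
    Finset.le_inf' _ _ fun c hc => by
      obtain ⟨z, rfl⟩ := hCδ c hc
      exact latticeSqDist_le hδ.ne' z
  have key := lintegral_mul_le_of_le_translate (measurable_gaussianPDF 0 v)
    (measurable_latticeSqDist a δ).ennreal_ofReal (δ := δ) (c := ENNReal.ofReal (δ ^ 3 / 12))
    (q := fun x => ENNReal.ofReal (gaussianPDFReal 0 v (|x| + δ)))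
    (Continuous.measurable (by fun_prop)).ennreal_ofReal (fun x u hu => ENNReal.ofReal_le_ofReal
      (gaussianPDFReal_le_of_abs_le v (by
        rw [abs_of_pos (a := |x| + δ) (by positivity)]
        exact (abs_add_le x u).trans (by rw [abs_of_pos hu.1]; linarith [hu.2]))))
    (fun x => setLIntegral_latticeSqDist a x hδ)
  rw [← ofReal_integral_eq_lintegral_ofReal hq (ae_of_all _ fun _ => gaussianPDFReal_nonneg _ _ _),
    ← ENNReal.ofReal_mul (integral_nonneg fun _ => gaussianPDFReal_nonneg _ _ _)] at key
  have hle : ∫⁻ y, gaussianPDF 0 v y * ENNReal.ofReal (latticeSqDist a δ y) ≤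
      ENNReal.ofReal (∫ y, C.inf' hC (fun c => (y - c) ^ 2) ∂(gaussianReal 0 v)) := by
    rw [ofReal_integral_eq_lintegral_ofReal (integrable_inf'_sq_sub v C hC)
      (ae_of_all _ (inf'_sq_sub_nonneg C hC)), gaussianReal_of_var_ne_zero 0 hv]
    have := lintegral_withDensity_eq_lintegral_mul volume (measurable_gaussianPDF 0 v)
      (measurable_latticeSqDist a δ).ennreal_ofReal
    simp only [Pi.mul_apply] at this
    rw [← this]
    exact lintegral_mono fun y => ENNReal.ofReal_le_ofReal (hG y)
  have h := key.trans (mul_le_mul_right hle _)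
  rw [← ENNReal.ofReal_mul hδ.le, ENNReal.ofReal_le_ofReal_iff (mul_nonneg hδ.le
    (integral_nonneg (inf'_sq_sub_nonneg C hC)))] at h
  refine le_of_mul_le_mul_left (le_of_eq_of_le ?_ h) hδ
  ring

/-- The overload distortion of a codebook at distance at least `1` from a unit interval. -/
lemma gaussianPDFReal_le_integral_inf' {v : ℝ≥0} (hv : v ≠ 0) {b p : ℝ}
    (C : Finset ℝ) (hC : C.Nonempty) (hb : ∀ y ∈ Set.Ioc p (p + 1), |y| ≤ |b|)
    (hCp : ∀ y ∈ Set.Ioc p (p + 1), ∀ c ∈ C, 1 ≤ |y - c|) :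
    gaussianPDFReal 0 v b ≤ ∫ y, C.inf' hC (fun c => (y - c) ^ 2) ∂(gaussianReal 0 v) := by
  have hone : ∀ y ∈ Set.Ioc p (p + 1), 1 ≤ C.inf' hC (fun c => (y - c) ^ 2) := fun y hy =>
    Finset.le_inf' _ _ fun c hc => by
      have := hCp y hy c hc
      rw [← sq_abs]
      nlinarith
  have hint := integrable_inf'_sq_sub v C hC
  calc gaussianPDFReal 0 v b = ∫ _ in Set.Ioc p (p + 1), gaussianPDFReal 0 v b := by simp
    _ ≤ ∫ y in Set.Ioc p (p + 1), gaussianPDFReal 0 v y :=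
        setIntegral_mono_on (by simp) (integrable_gaussianPDFReal 0 v).integrableOn
          measurableSet_Ioc fun y hy => gaussianPDFReal_le_of_abs_le v (hb y hy)
    _ = (gaussianReal 0 v).real (Set.Ioc p (p + 1)) := by
        rw [measureReal_def, gaussianReal_apply_eq_integral 0 hv, ENNReal.toReal_ofReal]
        exact integral_nonneg fun _ => gaussianPDFReal_nonneg _ _ _
    _ = ∫ _ in Set.Ioc p (p + 1), (1 : ℝ) ∂(gaussianReal 0 v) := by simp
    _ ≤ ∫ y in Set.Ioc p (p + 1), C.inf' hC (fun c => (y - c) ^ 2) ∂(gaussianReal 0 v) :=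
        setIntegral_mono_on (by simp) hint.integrableOn measurableSet_Ioc hone
    _ ≤ ∫ y, C.inf' hC (fun c => (y - c) ^ 2) ∂(gaussianReal 0 v) :=
        setIntegral_le_integral hint (ae_of_all _ (inf'_sq_sub_nonneg C hC))

/-- A uniform codebook with at most `n` elements either has a large overload distortion on one of
the two sides of `[-L, L]`, or is contained in a lattice of spacing comparable to `2 * L / n`. -/
lemma IsUniformCodebook.overload_or_granular {v : ℝ≥0} (hv : v ≠ 0) {C : Finset ℝ}
    (hC : C.Nonempty) (hCu : IsUniformCodebook C) {n : ℕ} (hn : C.card ≤ n) {L : ℝ} (hL : 0 < L) :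
    gaussianPDFReal 0 v (L + 2) ≤ ∫ y, C.inf' hC (fun c => (y - c) ^ 2) ∂(gaussianReal 0 v) ∨
      ∃ δ ∈ Set.Icc (2 * L / n) (2 * (2 * L / n)),
        δ ^ 2 / 12 * ∫ x, gaussianPDFReal 0 v (|x| + δ) ≤
          ∫ y, C.inf' hC (fun c => (y - c) ^ 2) ∂(gaussianReal 0 v) := by
  obtain ⟨a, Δ, M, hΔ, rfl⟩ := hCu
  have hM : M ≤ n := by
    rwa [Finset.card_image_of_injective, Finset.card_range] at hn
    intro i j hij
    simpa [hΔ.ne'] using hij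
  have hM0 : 0 < M := by
    rw [Finset.image_nonempty, Finset.nonempty_range_iff] at hC
    exact Nat.pos_of_ne_zero hC
  have hn0 : (0 : ℝ) < n := by exact_mod_cast hM0.trans_le hM
  have hMn : (M : ℝ) ≤ n := by exact_mod_cast hM
  have habs : |L + 2| = L + 2 := abs_of_pos (by linarith)
  by_cases h1 : a + M * Δ ≤ L + Δ
  · refine Or.inl (gaussianPDFReal_le_integral_inf' hv (p := L + 1) _ hC ?_ ?_)
    · intro y hy
      rw [habs, abs_le]
      constructor <;> linarith [hy.1, hy.2]
    · intro y hy c hc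
      obtain ⟨i, hi, rfl⟩ := Finset.mem_image.1 hc
      have hi : (i : ℝ) + 1 ≤ M := by exact_mod_cast Finset.mem_range.1 hi
      exact le_abs.2 (Or.inl (by nlinarith [hy.1]))
  by_cases h2 : -L ≤ a
  · refine Or.inl (gaussianPDFReal_le_integral_inf' hv (p := -(L + 2)) _ hC ?_ ?_)
    · intro y hy
      rw [habs, abs_le]
      constructor <;> linarith [hy.1, hy.2]
    · intro y hy c hc
      obtain ⟨i, hi, rfl⟩ := Finset.mem_image.1 hc
      have hi : (0 : ℝ) ≤ i * Δ := by positivity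
      exact le_abs.2 (Or.inr (by linarith [hy.2]))
  push Not at h1 h2
  right
  set d := 2 * L / n with hd
  have hd0 : 0 < d := by positivity
  have hdn : d * n = 2 * L := by rw [hd]; field_simp
  have hdΔ : d ≤ Δ := by
    by_contra! h
    nlinarith
  set k := ⌊Δ / d⌋₊ with hk
  have hk1 : 1 ≤ k := (Nat.one_le_floor_iff _).2 ((one_le_div hd0).2 hdΔ)
  have hk1' : (1 : ℝ) ≤ k := by exact_mod_cast hk1
  have hk0 : (0 : ℝ) < k := by linarith
  have hkle : k * d ≤ Δ := by
    rw [← le_div_iff₀ hd0]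
    exact Nat.floor_le (by positivity)
  have hklt : Δ < (k + 1) * d := by
    rw [← div_lt_iff₀ hd0]
    exact Nat.lt_floor_add_one _
  refine ⟨Δ / k, ⟨?_, ?_⟩,
    mul_integral_gaussianPDFReal_le_integral_inf' hv (a := a) (by positivity) _ hC ?_⟩
  · rw [le_div_iff₀ hk0]; linarith
  · rw [div_le_iff₀ hk0]; nlinarith
  · intro c hc
    obtain ⟨i, -, rfl⟩ := Finset.mem_image.1 hc
    refine ⟨i * k, ?_⟩
    push_cast
    field_simp

lemma eventually_mul_div_two_pow_le_gaussianPDFReal {v : ℝ≥0} (hv : v ≠ 0) {s : ℝ}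
    (hs0 : 0 < s) (hs : s < 4 * Real.log 2 * v) (B : ℝ) :
    ∀ᶠ R : ℕ in atTop, B * R / 2 ^ (2 * R) ≤ gaussianPDFReal 0 v (√(s * R) + 2) := by
  have hv0 : (0 : ℝ) < v := by exact_mod_cast pos_iff_ne_zero.2 hv
  have hR : Tendsto (fun R : ℕ => √(R : ℝ)) atTop atTop :=
    tendsto_sqrt_atTop.comp tendsto_natCast_atTop_atTop
  set K := (√(2 * π * v))⁻¹ with hKdef
  have hK : 0 < K := by positivity
  set α := 2 * Real.log 2 - s / (2 * v) with hα
  have hα0 : 0 < α := by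
    rw [hα, sub_pos, div_lt_iff₀ (by positivity)]
    linarith
  set β := 2 * √s / v with hβ
  have e1 := (tendsto_exp_div_pow_atTop 2).comp hR |>.eventually_ge_atTop (B / K)
  have e2 := hR.eventually_ge_atTop ((β + 1 + 2 / v) / α)
  filter_upwards [e1, e2, hR.eventually_ge_atTop 1] with R h1 h2 h3
  set x := √(R : ℝ) with hx
  have hxx : x ^ 2 = R := Real.sq_sqrt (Nat.cast_nonneg R)
  have hss : √s ^ 2 = s := Real.sq_sqrt hs0.le
  rw [Function.comp_apply, div_le_div_iff₀ hK (by positivity), hxx] at h1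
  rw [div_le_iff₀ hα0] at h2
  have hexp : x ≤ 2 * Real.log 2 * R + -(√(s * R) + 2 - 0) ^ 2 / (2 * v) := by
    rw [Real.sqrt_mul hs0.le, ← hx, ← hxx]
    have hid : 2 * Real.log 2 * x ^ 2 + -(√s * x + 2 - 0) ^ 2 / (2 * v) =
        α * x ^ 2 - β * x - 2 / v := by
      rw [hα, hβ]
      field_simp
      ring_nf
      rw [hss]
    rw [hid]
    have : 0 < 2 / (v : ℝ) := by positivity
    nlinarith
  have hpow : (2 : ℝ) ^ (2 * R) = Real.exp (2 * Real.log 2 * R) := by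
    rw [← Real.rpow_natCast, Real.rpow_def_of_pos two_pos]
    push_cast
    ring_nf
  rw [div_le_iff₀ (by positivity), hpow, gaussianPDFReal, ← hKdef, mul_assoc, ← Real.exp_add]
  rw [add_comm] at hexp
  nlinarith [Real.exp_le_exp.2 hexp]

/-- Sharp lower bound on the distortion of uniform codebooks for one Gaussian variable. -/
lemma eventually_le_integral_inf'_of_isUniformCodebook (v : ℝ≥0) {η : ℝ} (hη0 : 0 < η)
    (hη1 : η < 1) :
    ∀ᶠ R : ℕ in atTop, ∀ (C : Finset ℝ) (hC : C.Nonempty), IsUniformCodebook C → C.card ≤ 2 ^ R →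
      (1 - η) ^ 2 * (4 * Real.log 2 / 3) * v * (R / 2 ^ (2 * R)) ≤
        ∫ y, C.inf' hC (fun c => (y - c) ^ 2) ∂(gaussianReal 0 v) := by
  rcases eq_or_ne v 0 with rfl | hv
  · filter_upwards with R C hC _ _
    simpa using inf'_sq_sub_nonneg C hC 0
  have hv0 : (0 : ℝ) < v := by exact_mod_cast pos_iff_ne_zero.2 hv
  have hlog : 0 < Real.log 2 := Real.log_pos one_lt_two
  set s := (1 - η) * (4 * Real.log 2 * v) with hs
  have hs0 : 0 < s := mul_pos (by linarith) (by positivity)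
  have hs1 : s < 4 * Real.log 2 * v := by
    have : 0 < 4 * Real.log 2 * v := by positivity
    nlinarith
  have hI := (tendsto_integral_gaussianPDFReal_abs_add hv).eventually
    (lt_mem_nhds (show 1 - η < 1 by linarith))
  obtain ⟨d, hd0, hd⟩ := mem_nhdsGT_iff_exists_Ioo_subset.1 hI
  have hstep : Tendsto (fun R : ℕ => 4 * √s * ((R : ℝ) ^ 1 / 2 ^ R)) atTop (nhds (4 * √s * 0)) :=
    (tendsto_pow_const_div_const_pow_of_one_lt 1 one_lt_two).const_mul _
  rw [mul_zero] at hstep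
  filter_upwards [eventually_mul_div_two_pow_le_gaussianPDFReal hv hs0 hs1
    ((1 - η) ^ 2 * (4 * Real.log 2 / 3) * v), hstep.eventually (gt_mem_nhds hd0),
    eventually_ge_atTop 1] with R h1 h2 hR C hC hCu hcard
  have hR1 : (1 : ℝ) ≤ R := by exact_mod_cast hR
  have hL : 0 < √(s * R) := by positivity
  rcases hCu.overload_or_granular hv hC hcard hL with h | ⟨δ, ⟨hδ1, hδ2⟩, h⟩
  · rw [← mul_div_assoc]
    exact h1.trans h
  · push_cast at hδ1 hδ2
    have hδ0 : 0 < δ := lt_of_lt_of_le (by positivity) hδ1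
    have hδd : δ < d := by
      refine lt_of_le_of_lt ?_ h2
      refine hδ2.trans ?_
      rw [Real.sqrt_mul hs0.le, pow_one]
      have hRle : √(R : ℝ) ≤ R := by
        rw [Real.sqrt_le_left (by linarith)]
        nlinarith
      calc 2 * (2 * (√s * √(R : ℝ)) / 2 ^ R) = 4 * √s * (√(R : ℝ) / 2 ^ R) := by ring
        _ ≤ _ := by gcongr
    have hint : 1 - η < ∫ x, gaussianPDFReal 0 v (|x| + δ) := hd ⟨hδ0, hδd⟩
    refine le_trans ?_ h
    have hsq : 4 * (s * R) / 2 ^ (2 * R) ≤ δ ^ 2 := by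
      have := pow_le_pow_left₀ (by positivity) hδ1 2
      rw [div_pow, mul_pow, Real.sq_sqrt (by positivity), ← pow_mul, mul_comm R] at this
      linarith
    calc (1 - η) ^ 2 * (4 * Real.log 2 / 3) * v * (R / 2 ^ (2 * R))
        = 4 * (s * R) / 2 ^ (2 * R) / 12 * (1 - η) := by rw [hs]; ring
      _ ≤ _ := by gcongr

lemma inf'_sq_sub_le_of_symmetric {L t : ℝ} (hL : 0 < L) (ht : 0 < t) {n : ℕ} (hn : 0 < n)
    (hC : (Finset.image (fun i : ℕ => -L + i * (2 * L / n)) (Finset.range n)).Nonempty) (y : ℝ) :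
    (Finset.image (fun i : ℕ => -L + i * (2 * L / n)) (Finset.range n)).inf' hC
        (fun c => (y - c) ^ 2) ≤
      2 * (2 * L / n) ^ 2 +
        4 / t ^ 2 * Real.exp (-(t * L)) * (Real.exp (t * y) + Real.exp (-t * y)) := by
  have hn0 : (0 : ℝ) < n := by exact_mod_cast hn
  set Δ := 2 * L / n with hΔ
  have hΔ0 : 0 < Δ := by positivity
  have hΔn : n * Δ = 2 * L := by rw [hΔ]; field_simp
  have hmem : ∀ i < n, (Finset.image (fun i : ℕ => -L + i * Δ) (Finset.range n)).inf' hC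
      (fun c => (y - c) ^ 2) ≤ (y - (-L + i * Δ)) ^ 2 := fun i hi =>
    Finset.inf'_le _ (Finset.mem_image_of_mem _ (Finset.mem_range.2 hi))
  have hquad : ∀ x : ℝ, 0 ≤ x → 2 * x ^ 2 ≤ 4 / t ^ 2 * Real.exp (t * x) := fun x hx => by
    have h0 : 0 ≤ t * x := by positivity
    have h := Real.quadratic_le_exp_of_nonneg h0
    rw [div_mul_eq_mul_div, le_div_iff₀ (by positivity)]
    nlinarith
  have hsplit : 4 / t ^ 2 * Real.exp (-(t * L)) * (Real.exp (t * y) + Real.exp (-t * y)) =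
      4 / t ^ 2 * Real.exp (t * (y - L)) + 4 / t ^ 2 * Real.exp (t * (-y - L)) := by
    rw [mul_assoc, mul_add, ← Real.exp_add, ← Real.exp_add, ← mul_add]
    ring_nf
  rw [hsplit]
  have hpos1 : 0 ≤ 4 / t ^ 2 * Real.exp (t * (y - L)) := by positivity
  have hpos2 : 0 ≤ 4 / t ^ 2 * Real.exp (t * (-y - L)) := by positivity
  rcases lt_or_ge y (-L) with h1 | h1
  · have h := hmem 0 hn
    have h' := hquad (-y - L) (by linarith)
    push_cast at h
    nlinarith [sq_nonneg (-y - L), sq_nonneg Δ]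
  rcases lt_or_ge y L with h2 | h2
  · have h0 : 0 ≤ (y + L) / Δ := div_nonneg (by linarith) hΔ0.le
    have hfl : ⌊(y + L) / Δ⌋₊ < n := by
      rw [Nat.floor_lt h0, div_lt_iff₀ hΔ0, hΔn]
      linarith
    have h := hmem _ hfl
    have hl := (le_div_iff₀ hΔ0).1 (Nat.floor_le h0)
    have hu := (div_lt_iff₀ hΔ0).1 (Nat.lt_floor_add_one ((y + L) / Δ))
    have : (y - (-L + ⌊(y + L) / Δ⌋₊ * Δ)) ^ 2 ≤ Δ ^ 2 := by
      apply sq_le_sq' <;> linarith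
    nlinarith [sq_nonneg Δ]
  · have h := hmem (n - 1) (by lia)
    have h' := hquad (y - L) (by linarith)
    rw [Nat.cast_sub hn] at h
    have he : y - (-L + ((n : ℝ) - (1 : ℕ)) * Δ) = (y - L) + Δ := by
      push_cast
      linarith
    rw [he] at h
    nlinarith [sq_nonneg (y - L - Δ)]

/-- A uniform codebook achieving the order `R / 2 ^ (2 * R)` for all variances at most `V`. -/
lemma exists_isUniformCodebook_integral_inf'_le {V : ℝ} (hV : 0 < V) {R : ℕ} (hR : 1 ≤ R) :
    ∃ (C : Finset ℝ) (hC : C.Nonempty), IsUniformCodebook C ∧ C.card ≤ 2 ^ R ∧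
      ∀ v : ℝ≥0, (v : ℝ) ≤ V →
        ∫ y, C.inf' hC (fun c => (y - c) ^ 2) ∂(gaussianReal 0 v) ≤
          (32 * Real.log 2 * V + 2 * V / Real.log 2) * (R / 2 ^ (2 * R)) := by
  have hR1 : (1 : ℝ) ≤ R := by exact_mod_cast hR
  have hlog : 0 < Real.log 2 := Real.log_pos one_lt_two
  set L := √(4 * Real.log 2 * V * R) with hLdef
  have hL : 0 < L := by positivity
  have hLsq : L ^ 2 = 4 * Real.log 2 * V * R := Real.sq_sqrt (by positivity)
  have hn : 0 < 2 ^ R := by positivity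
  have hC : (Finset.image (fun i : ℕ => -L + i * (2 * L / (2 ^ R : ℕ)))
      (Finset.range (2 ^ R))).Nonempty := by simp
  refine ⟨_, hC, ⟨-L, 2 * L / (2 ^ R : ℕ), 2 ^ R, by positivity, rfl⟩,
    Finset.card_image_le.trans (by simp), fun v hv => ?_⟩
  set t := L / V with ht
  have ht0 : 0 < t := by positivity
  have he1 : Integrable (fun y => Real.exp (t * y)) (gaussianReal 0 v) :=
    integrable_exp_mul_gaussianReal t
  have he2 : Integrable (fun y => Real.exp (-t * y)) (gaussianReal 0 v) :=
    integrable_exp_mul_gaussianReal (-t)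
  have hmgf : ∀ r : ℝ, ∫ y, Real.exp (r * y) ∂(gaussianReal 0 v) = Real.exp (v * r ^ 2 / 2) :=
    fun r => by simpa [mgf] using congrFun (mgf_id_gaussianReal (μ := 0) (v := v)) r
  have hexp : Real.exp (-(t * L)) * Real.exp (v * t ^ 2 / 2) ≤ 1 / 2 ^ (2 * R) := by
    have hpow : (2 : ℝ) ^ (2 * R) = Real.exp (2 * Real.log 2 * R) := by
      rw [← Real.rpow_natCast, Real.rpow_def_of_pos two_pos]
      push_cast
      ring_nf
    rw [hpow, ← Real.exp_add, one_div, ← Real.exp_neg, Real.exp_le_exp]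
    have h1 : v * t ^ 2 / 2 ≤ V * t ^ 2 / 2 := by gcongr
    have h2 : -(t * L) + V * t ^ 2 / 2 = -(2 * Real.log 2 * R) := by
      have : -(t * L) + V * t ^ 2 / 2 = -(L ^ 2 / (2 * V)) := by rw [ht]; field_simp; ring
      rw [this, hLsq]
      field_simp
      ring
    linarith
  have ht2 : 4 / t ^ 2 ≤ V / Real.log 2 * R := by
    have : 4 / t ^ 2 = V / Real.log 2 / R := by
      rw [ht, div_pow, hLsq]
      field_simp
    rw [this]
    have : 0 ≤ V / Real.log 2 := by positivity
    exact (div_le_self this hR1).trans (le_mul_of_one_le_right this hR1)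
  calc _ ≤ ∫ y, 2 * (2 * L / (2 ^ R : ℕ)) ^ 2 +
        4 / t ^ 2 * Real.exp (-(t * L)) * (Real.exp (t * y) + Real.exp (-t * y))
          ∂(gaussianReal 0 v) :=
        integral_mono (integrable_inf'_sq_sub v _ hC)
          ((integrable_const _).add ((he1.add he2).const_mul _))
          (inf'_sq_sub_le_of_symmetric hL ht0 hn hC)
    _ = 2 * (2 * L / (2 ^ R : ℕ)) ^ 2 +
        2 * (4 / t ^ 2 * (Real.exp (-(t * L)) * Real.exp (v * t ^ 2 / 2))) := by
        have he : Integrable (fun y => Real.exp (t * y) + Real.exp (-t * y)) (gaussianReal 0 v) :=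
          he1.add he2
        rw [integral_add (integrable_const _) (he.const_mul _), integral_const_mul
          (4 / t ^ 2 * Real.exp (-(t * L))), integral_add he1 he2, hmgf, hmgf]
        simp
        ring
    _ ≤ 2 * (2 * L / (2 ^ R : ℕ)) ^ 2 + 2 * (V / Real.log 2 * R * (1 / 2 ^ (2 * R))) := by
        gcongr
    _ = _ := by
        rw [div_pow, mul_pow, hLsq]
        push_cast
        rw [← pow_mul, mul_comm R]
        ring

lemma choose_mul_sum_powersetCard_sum {N K : ℕ} (hK : 1 ≤ K) (hKN : K ≤ N) (b : Fin N → ℝ) :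
    1 / (N.choose K : ℝ) * ∑ T ∈ Finset.powersetCard K (Finset.univ : Finset (Fin N)),
      ∑ j ∈ T, b j = K / N * ∑ j, b j := by
  have hcount : ∀ j : Fin N,
      ((Finset.powersetCard K (Finset.univ : Finset (Fin N))).filter (j ∈ ·)).card =
        (N - 1).choose (K - 1) := fun j => by
    simpa using Finset.card_filter_powersetCard_subset {j} Finset.univ K (by simp) (by simpa)
  have hsum : ∑ T ∈ Finset.powersetCard K (Finset.univ : Finset (Fin N)), ∑ j ∈ T, b j =
      ((N - 1).choose (K - 1) : ℝ) * ∑ j, b j := by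
    calc _ = ∑ T ∈ Finset.powersetCard K (Finset.univ : Finset (Fin N)),
          ∑ j, if j ∈ T then b j else 0 := by simp
      _ = ∑ j, ∑ T ∈ Finset.powersetCard K (Finset.univ : Finset (Fin N)),
          if j ∈ T then b j else 0 := Finset.sum_comm
      _ = _ := by
        rw [Finset.mul_sum]
        refine Finset.sum_congr rfl fun j _ => ?_
        rw [← Finset.sum_filter, Finset.sum_const, hcount, nsmul_eq_mul]
  have hchoose : (N : ℝ) * (N - 1).choose (K - 1) = N.choose K * K := by
    have h := Nat.add_one_mul_choose_eq (N - 1) (K - 1)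
    rw [Nat.sub_add_cancel hK, Nat.sub_add_cancel (hK.trans hKN)] at h
    exact_mod_cast h
  have hN : (N : ℝ) ≠ 0 := by exact_mod_cast (Nat.pos_of_ne_zero (by lia)).ne'
  have hNK : (N.choose K : ℝ) ≠ 0 := by exact_mod_cast (Nat.choose_pos hKN).ne'
  rw [hsum]
  field_simp
  linear_combination (∑ j, b j) * hchoose

lemma measDist_nonneg {m N : ℕ} (Φ : Matrix (Fin m) (Fin N) ℝ) (K : ℕ) (C : Finset ℝ)
    (hC : C.Nonempty) : 0 ≤ measDist Φ K C hC := by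
  unfold measDist
  exact mul_nonneg (by positivity) (Finset.sum_nonneg fun T _ => Finset.sum_nonneg fun i _ =>
    integral_nonneg (inf'_sq_sub_nonneg C hC))

lemma bddBelow_measDist {m N : ℕ} (Φ : Matrix (Fin m) (Fin N) ℝ) (K R : ℕ) :
    BddBelow {d : ℝ | ∃ (C : Finset ℝ) (hC : C.Nonempty), IsUniformCodebook C ∧ C.card ≤ 2 ^ R ∧
      d = measDist Φ K C hC} :=
  ⟨0, by rintro _ ⟨C, hC, -, -, rfl⟩; exact measDist_nonneg Φ K C hC⟩

lemma exists_DuSQ_le {m N K : ℕ} (Φ : Matrix (Fin m) (Fin N) ℝ) (hKN : K ≤ N) :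
    ∃ B : ℝ, ∀ R : ℕ, 1 ≤ R → DuSQ Φ K R ≤ B * (R / 2 ^ (2 * R)) := by
  set V : ℝ := 1 + ∑ i, ∑ j, Φ i j ^ 2 with hV
  have hV0 : 0 < V := by positivity
  set B := 32 * Real.log 2 * V + 2 * V / Real.log 2 with hB
  refine ⟨m * B, fun R hR => ?_⟩
  obtain ⟨C, hC, hCu, hcard, hle⟩ := exists_isUniformCodebook_integral_inf'_le hV0 hR
  refine (csInf_le (bddBelow_measDist Φ K R) ⟨C, hC, hCu, hcard, rfl⟩).trans ?_
  have hterm : ∀ T ∈ Finset.powersetCard K (Finset.univ : Finset (Fin N)),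
      ∑ i : Fin m, ∫ y, C.inf' hC (fun c => (y - c) ^ 2)
        ∂(gaussianReal 0 (Real.toNNReal (∑ j ∈ T, (Φ i j) ^ 2))) ≤
      m * (B * (R / 2 ^ (2 * R))) := fun T _ => by
    calc _ ≤ ∑ i : Fin m, B * (R / 2 ^ (2 * R)) := by
          refine Finset.sum_le_sum fun i _ => hle _ ?_
          rw [Real.coe_toNNReal _ (by positivity)]
          have h1 : ∑ j ∈ T, Φ i j ^ 2 ≤ ∑ j, Φ i j ^ 2 :=
            Finset.sum_le_sum_of_subset_of_nonneg (Finset.subset_univ T)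
              fun _ _ _ => sq_nonneg _
          have h2 : ∑ j, Φ i j ^ 2 ≤ ∑ i, ∑ j, Φ i j ^ 2 :=
            Finset.single_le_sum (f := fun i => ∑ j, Φ i j ^ 2)
              (fun _ _ => by positivity) (Finset.mem_univ i)
          linarith
      _ = _ := by simp
  have hNK : (0 : ℝ) < N.choose K := by exact_mod_cast Nat.choose_pos hKN
  rw [measDist, one_div, inv_mul_le_iff₀ hNK]
  refine (Finset.sum_le_sum hterm).trans (le_of_eq ?_)
  rw [Finset.sum_const, Finset.card_powersetCard, Finset.card_univ, Fintype.card_fin, nsmul_eq_mul]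
  ring

lemma eventually_le_DuSQ {m N K : ℕ} (Φ : Matrix (Fin m) (Fin N) ℝ) (hK1 : 1 ≤ K) (hKN : K ≤ N)
    {η : ℝ} (hη0 : 0 < η) (hη1 : η < 1) :
    ∀ᶠ R : ℕ in atTop, (1 - η) ^ 2 * (4 * Real.log 2 / 3) * (R / 2 ^ (2 * R)) *
      (K / N * ∑ i : Fin m, ∑ j : Fin N, Φ i j ^ 2) ≤ DuSQ Φ K R := by
  have hev := (Finset.eventually_all (Finset.powersetCard K (Finset.univ : Finset (Fin N)))).2
    fun T _ => eventually_all.2 fun i : Fin m =>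
      eventually_le_integral_inf'_of_isUniformCodebook
        (Real.toNNReal (∑ j ∈ T, (Φ i j) ^ 2)) hη0 hη1
  filter_upwards [hev, eventually_ge_atTop 1] with R hR hR1
  obtain ⟨C₀, hC₀, hC₀u, hcard₀, -⟩ := exists_isUniformCodebook_integral_inf'_le one_pos hR1
  refine le_csInf ⟨_, C₀, hC₀, hC₀u, hcard₀, rfl⟩ ?_
  rintro _ ⟨C, hC, hCu, hcard, rfl⟩
  set c := (1 - η) ^ 2 * (4 * Real.log 2 / 3) with hc
  have hsum : ∀ T ∈ Finset.powersetCard K (Finset.univ : Finset (Fin N)),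
      c * (R / 2 ^ (2 * R)) * ∑ i, ∑ j ∈ T, Φ i j ^ 2 ≤
        ∑ i : Fin m, ∫ y, C.inf' hC (fun c => (y - c) ^ 2)
          ∂(gaussianReal 0 (Real.toNNReal (∑ j ∈ T, (Φ i j) ^ 2))) := fun T hT => by
    rw [Finset.mul_sum]
    refine Finset.sum_le_sum fun i _ => ?_
    have h := hR T hT i C hC hCu hcard
    rw [Real.coe_toNNReal _ (by positivity)] at h
    linarith
  rw [measDist]
  refine le_trans (le_of_eq ?_) (mul_le_mul_of_nonneg_left (Finset.sum_le_sum hsum) (by positivity))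
  rw [← Finset.mul_sum, mul_left_comm (1 / (N.choose K : ℝ)), Finset.sum_comm,
    ← choose_mul_sum_powersetCard_sum hK1 hKN fun j => ∑ i, Φ i j ^ 2]
  congr 3 with T
  exact Finset.sum_comm

/-- Theorem 2, equation (12):
`liminf_{R→∞} (2^{2R}/(K R)) D_{u,SQ}*(R) ≥ (4 ln 2 / 3) μ₁`
with `μ₁ = (1/N) ∑_{i,j} φ_{i,j}²`. -/
theorem stmt4 {m N K : ℕ} (Φ : Matrix (Fin m) (Fin N) ℝ) (hK1 : 1 ≤ K) (hKN : K ≤ N) :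
    4 * Real.log 2 / 3 * ((1 / (N : ℝ)) * ∑ i : Fin m, ∑ j : Fin N, (Φ i j) ^ 2) ≤
      Filter.liminf
        (fun R : ℕ => (2 : ℝ) ^ (2 * R) / ((K : ℝ) * (R : ℝ)) * DuSQ Φ K R)
        Filter.atTop := by
  have hK : (0 : ℝ) < K := by exact_mod_cast hK1
  set A := 4 * Real.log 2 / 3 * ((1 / (N : ℝ)) * ∑ i : Fin m, ∑ j : Fin N, (Φ i j) ^ 2) with hA
  have hcobdd : IsCoboundedUnder (· ≥ ·) atTop
      (fun R : ℕ => (2 : ℝ) ^ (2 * R) / ((K : ℝ) * (R : ℝ)) * DuSQ Φ K R) := by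
    obtain ⟨B, hB⟩ := exists_DuSQ_le Φ hKN
    refine IsBoundedUnder.isCoboundedUnder_ge ⟨B / K, ?_⟩
    rw [eventually_map]
    filter_upwards [eventually_ge_atTop 1] with R hR
    have hR0 : (0 : ℝ) < R := by exact_mod_cast hR
    calc _ ≤ (2 : ℝ) ^ (2 * R) / ((K : ℝ) * (R : ℝ)) * (B * (R / 2 ^ (2 * R))) := by
          gcongr
          exact hB R hR
      _ = B / K := by field_simp
  have hlower : ∀ η ∈ Set.Ioo (0 : ℝ) 1, (1 - η) ^ 2 * A ≤ Filter.liminf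
      (fun R : ℕ => (2 : ℝ) ^ (2 * R) / ((K : ℝ) * (R : ℝ)) * DuSQ Φ K R) Filter.atTop := by
    rintro η ⟨hη0, hη1⟩
    refine le_liminf_of_le hcobdd ?_
    filter_upwards [eventually_le_DuSQ Φ hK1 hKN hη0 hη1, eventually_ge_atTop 1] with R h hR
    have hR0 : (0 : ℝ) < R := by exact_mod_cast hR
    refine le_trans (le_of_eq ?_) (mul_le_mul_of_nonneg_left h (by positivity))
    rw [hA]
    field_simp
  have hlim : Tendsto (fun η : ℝ => (1 - η) ^ 2 * A) (nhdsWithin 0 (Set.Ioi 0)) (nhds A) := by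
    have h : Tendsto (fun η : ℝ => (1 - η) ^ 2 * A) (nhds 0) (nhds ((1 - 0) ^ 2 * A)) :=
      Continuous.tendsto (by fun_prop) 0
    rw [sub_zero, one_pow, one_mul] at h
    exact h.mono_left nhdsWithin_le_nhds
  exact le_of_tendsto hlim (Filter.mem_of_superset (Ioo_mem_nhdsGT one_pos) hlower)
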